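/- Under the standing hypotheses, a + 3d cannot be written in the 3-weak dominated form: there is no nonnegative integer y such that a + 3d = 3^{m-1} + 2^y. -/

import Mathlib

theorem three_pow_mod_eight (k : ℕ) : 3 ^ k % 8 = 1 ∨ 3 ^ k % 8 = 3 := by
  induction k with
  | zero => simp
  | succ k ih => rw [pow_succ]; omega

theorem three_pow_cases (k : ℕ) : 3 ^ k = 1 ∨ 3 ^ k = 3 ∨ 3 ^ k % 9 = 0 := by
  match k with
  | 0 => simp
  | 1 => simp
  | k + 2 => right; right; rw [pow_add]; omega

theorem two_pow_mod_three (k : ℕ) : 2 ^ k % 3 = 1 ∨ 2 ^ k % 3 = 2 := by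
  induction k with
  | zero => simp
  | succ k ih => rw [pow_succ]; omega

theorem two_pow_cases (k : ℕ) :
    2 ^ k = 1 ∨ 2 ^ k = 2 ∨ 2 ^ k = 4 ∨ 2 ^ k = 8 ∨ 2 ^ k = 16 ∨ 2 ^ k % 32 = 0 := by
  match k with
  | 0 => simp
  | 1 => simp
  | 2 => simp
  | 3 => simp
  | 4 => simp
  | k + 5 => iterate 5 right
             rw [pow_add]; omega

theorem three_pow_ne_two_pow_add_one (k l : ℕ) : 3 ^ k ≠ 2 ^ (l + 4) + 1 := by
  have h₃ : 3 ^ k % 80 = 1 ∨ 3 ^ k % 80 = 3 ∨ 3 ^ k % 80 = 9 ∨ 3 ^ k % 80 = 27 := by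
    induction k with
    | zero => simp
    | succ k ih => rw [pow_succ]; omega
  have h₂ : 2 ^ (l + 4) % 80 = 16 ∨ 2 ^ (l + 4) % 80 = 32 ∨ 2 ^ (l + 4) % 80 = 64 ∨
      2 ^ (l + 4) % 80 = 48 := by
    induction l with
    | zero => simp
    | succ l ih => rw [Nat.add_right_comm, pow_succ]; omega
  omega

theorem mul_pow_le_pow_of_pow_lt {b x z : ℕ} (hb : 1 < b) (h : b ^ x < b ^ z) :
    b * b ^ x ≤ b ^ z := by
  rw [← pow_succ']
  exact Nat.pow_le_pow_right (by omega) ((Nat.pow_lt_pow_iff_right hb).1 h)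

/-- Three even numbers of the form `3 ^ x + 2 ^ y` are never in arithmetic progression. -/
theorem not_three_even_of_progression {b e : ℕ} (he : 0 < e) (hb : b % 2 = 0) (he₂ : e % 2 = 0)
    (h₀ : ∃ x y : ℕ, b = 3 ^ x + 2 ^ y) (h₁ : ∃ x y : ℕ, b + e = 3 ^ x + 2 ^ y)
    (h₂ : ∃ x y : ℕ, b + 2 * e = 3 ^ x + 2 ^ y) : False := by
  obtain ⟨x₀, y₀, h₀⟩ := h₀
  obtain ⟨x₁, y₁, h₁⟩ := h₁
  obtain ⟨x₂, y₂, h₂⟩ := h₂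
  have a₀ := three_pow_mod_eight x₀
  have a₁ := three_pow_mod_eight x₁
  have a₂ := three_pow_mod_eight x₂
  have b₀ := two_pow_cases y₀
  have b₁ := two_pow_cases y₁
  have b₂ := two_pow_cases y₂
  have c₀ : 2 ^ y₀ = 1 := by omega
  have c₁ : 2 ^ y₁ = 1 := by omega
  have c₂ : 2 ^ y₂ = 1 := by omega
  have := mul_pow_le_pow_of_pow_lt (b := 3) (x := x₁) (z := x₂) (by norm_num) (by omega)
  omega

/-- A progression of seven terms `3 ^ x + 2 ^ y` has odd first term and even difference. -/
theorem odd_and_even_of_progression {a d : ℕ} (hd : 0 < d)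
    (hAP : ∀ i : ℕ, i ≤ 6 → ∃ x y : ℕ, a + i * d = 3 ^ x + 2 ^ y) :
    a % 2 = 1 ∧ d % 2 = 0 := by
  have ha : a % 2 = 1 := by
    by_contra h
    refine not_three_even_of_progression (b := a) (e := 2 * d) (by omega) (by omega) (by omega)
      ?_ ?_ ?_
    · simpa using hAP 0 (by norm_num)
    · exact hAP 2 (by norm_num)
    · simpa [← mul_assoc] using hAP 4 (by norm_num)
  refine ⟨ha, ?_⟩
  by_contra h
  refine not_three_even_of_progression (b := a + 1 * d) (e := 2 * d) (by omega) (by omega)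
    (by omega) (hAP 1 (by norm_num)) ?_ ?_
  · rw [add_assoc, ← add_mul]; exact hAP 3 (by norm_num)
  · rw [add_assoc, ← mul_assoc, ← add_mul]; exact hAP 5 (by norm_num)

/-- A number `3 ^ x + 2 ^ y` in `(2L/3, L]` involves the largest power of `3` or of `2` up to `L`,
or the second largest of both. -/
theorem dominant_power_cases {L t p q x y : ℕ} (hp₁ : 9 * 3 ^ p ≤ L) (hp₂ : L < 27 * 3 ^ p)
    (hq₁ : 8 * 2 ^ q ≤ L) (hq₂ : L < 16 * 2 ^ q) (ht : t = 3 ^ x + 2 ^ y) (htL : t ≤ L)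
    (hLt : 2 * L < 3 * t) :
    (3 ^ x = 9 * 3 ^ p) ∨ (3 ^ x < 9 * 3 ^ p ∧ 2 ^ y = 8 * 2 ^ q) ∨
      (3 ^ x = 3 * 3 ^ p ∧ 2 ^ y = 4 * 2 ^ q) := by
  have hX : 0 < 3 ^ x := by positivity
  have hY : 0 < 2 ^ y := by positivity
  have e₂ : 3 ^ (p + 2) = 9 * 3 ^ p := by ring
  have e₁ : 3 ^ (p + 1) = 3 * 3 ^ p := by ring
  have f₃ : 2 ^ (q + 3) = 8 * 2 ^ q := by ring
  have f₂ : 2 ^ (q + 2) = 4 * 2 ^ q := by ring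
  have hx : x ≤ p + 2 := by
    by_contra h
    have := Nat.pow_le_pow_right (n := 3) (by norm_num) (show p + 3 ≤ x by omega)
    have : 3 ^ (p + 3) = 27 * 3 ^ p := by ring
    omega
  have hy : y ≤ q + 3 := by
    by_contra h
    have := Nat.pow_le_pow_right (n := 2) (by norm_num) (show q + 4 ≤ y by omega)
    have : 2 ^ (q + 4) = 16 * 2 ^ q := by ring
    omega
  rcases Nat.eq_or_lt_of_le hx with rfl | hx
  · omega
  have hx' := Nat.pow_le_pow_right (n := 3) (by norm_num) (show x ≤ p + 1 by omega)
  rcases Nat.eq_or_lt_of_le hy with rfl | hy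
  · have : 0 < 3 ^ p := by positivity
    omega
  have hy' := Nat.pow_le_pow_right (n := 2) (by norm_num) (show y ≤ q + 2 by omega)
  rcases Nat.eq_or_lt_of_le (show x ≤ p + 1 by omega) with rfl | hx₁
  · rcases Nat.eq_or_lt_of_le (show y ≤ q + 2 by omega) with rfl | hy₁
    · omega
    · have := Nat.pow_le_pow_right (n := 2) (by norm_num) (show y ≤ q + 1 by omega)
      have : 2 ^ (q + 1) = 2 * 2 ^ q := by ring
      omega
  · have := Nat.pow_le_pow_right (n := 3) (by norm_num) (show x ≤ p by omega)
    omega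

/-- If `3 ^ (p + 1) + 2 ^ y` lies in `(L/2, L]`, then `2 ^ y` is one of the three largest powers
of `2` up to `L`. -/
theorem two_pow_eq_of_half_lt {L t p q y : ℕ} (hp : 9 * 3 ^ p ≤ L)
    (hq₁ : 8 * 2 ^ q ≤ L) (hq₂ : L < 16 * 2 ^ q) (ht : t = 3 * 3 ^ p + 2 ^ y) (htL : t ≤ L)
    (hLt : L < 2 * t) :
    2 ^ y = 8 * 2 ^ q ∨ 2 ^ y = 4 * 2 ^ q ∨ 2 ^ y = 2 * 2 ^ q := by
  have hy : y ≤ q + 3 := by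
    by_contra h
    have := Nat.pow_le_pow_right (n := 2) (by norm_num) (show q + 4 ≤ y by omega)
    have : 2 ^ (q + 4) = 16 * 2 ^ q := by ring
    omega
  have hy' : q < y := by
    by_contra h
    have := Nat.pow_le_pow_right (n := 2) (by norm_num) (show y ≤ q by omega)
    omega
  obtain rfl | rfl | rfl : y = q + 3 ∨ y = q + 2 ∨ y = q + 1 := by omega
  · left; ring
  · right; left; ring
  · right; right; ring

/-- The powers `P` of `3` and `Q` of `2` are large, and `Y` is `2 * Q`, `4 * Q` or `8 * Q`. -/
structure Scale (P Q Y : ℕ) : Prop where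
  P_mod_eight : P % 8 = 1 ∨ P % 8 = 3
  P_mod_nine : P % 9 = 0
  P_ge : 9 ≤ P
  Q_mod_three : Q % 3 = 1 ∨ Q % 3 = 2
  Q_mod : Q % 32 = 0
  Y_eq : Y = 8 * Q ∨ Y = 4 * Q ∨ Y = 2 * Q
  ne_one : 3 * P ≠ Q + 1
  ne_two : 3 * P ≠ 2 * Q + 1
  ne_four : 3 * P ≠ 4 * Q + 1

/-- The congruences and gaps used for a power of `3`. -/
structure ThreePow (X : ℕ) : Prop where
  mod_eight : X % 8 = 1 ∨ X % 8 = 3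
  cases : X = 1 ∨ X = 3 ∨ X % 9 = 0

/-- The congruences and gaps used for an even power of `2`. -/
structure EvenTwoPow (Y : ℕ) : Prop where
  pos : 0 < Y
  cases : Y = 2 ∨ Y = 4 ∨ Y = 8 ∨ Y = 16 ∨ Y % 32 = 0

theorem threePow_pow (k : ℕ) : ThreePow (3 ^ k) := ⟨three_pow_mod_eight k, three_pow_cases k⟩

theorem evenTwoPow_pow {k : ℕ} (h : 2 ^ k % 2 = 0) : EvenTwoPow (2 ^ k) :=
  ⟨by positivity, by have := two_pow_cases k; omega⟩

theorem scale_pow {p q Y : ℕ} (hp : 7 ≤ p) (hq : 11 ≤ q)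
    (hY : Y = 8 * 2 ^ q ∨ Y = 4 * 2 ^ q ∨ Y = 2 * 2 ^ q) : Scale (3 ^ p) (2 ^ q) Y := by
  have hp₂ := Nat.pow_le_pow_right (n := 3) (by norm_num) (show 2 ≤ p by omega)
  have hq₅ := Nat.pow_le_pow_right (n := 2) (by norm_num) (show 5 ≤ q by omega)
  have hpc := three_pow_cases p
  have hqc := two_pow_cases q
  refine ⟨three_pow_mod_eight p, by omega, by omega, two_pow_mod_three q, by omega, hY,
    ?_, ?_, ?_⟩
  · obtain ⟨r, rfl⟩ := Nat.exists_eq_add_of_le' (show 4 ≤ q by omega)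
    have := three_pow_ne_two_pow_add_one (p + 1) r
    rwa [pow_succ'] at this
  · obtain ⟨r, rfl⟩ := Nat.exists_eq_add_of_le' (show 3 ≤ q by omega)
    have := three_pow_ne_two_pow_add_one (p + 1) r
    rwa [pow_succ', show 2 ^ (r + 4) = 2 * 2 ^ (r + 3) by ring] at this
  · obtain ⟨r, rfl⟩ := Nat.exists_eq_add_of_le' (show 2 ≤ q by omega)
    have := three_pow_ne_two_pow_add_one (p + 1) r
    rwa [pow_succ', show 2 ^ (r + 4) = 4 * 2 ^ (r + 2) by ring] at this

namespace Scale

theorem Y_mod {P Q Y : ℕ} (s : Scale P Q Y) : Y % 32 = 0 := by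
  obtain ⟨-, -, -, -, Q_mod, Y_eq, -, -, -⟩ := s
  omega

theorem false_of_both {P Q Y X₅ Y₅ d : ℕ} (s : Scale P Q Y) (hX : ThreePow X₅)
    (hY : Y₅ % 3 ≠ 0) (hd : 0 < d)
    (h₄ : 3 * P + Y + d = 3 * P + 4 * Q) (h₅ : 3 * P + Y + 2 * d = X₅ + Y₅)
    (c₅ : X₅ = 9 * P ∨ (X₅ < 9 * P ∧ Y₅ = 8 * Q)) : False := by
  obtain ⟨-, P₉, -, Q₃, -, Y_eq, -, ne, -⟩ := s
  obtain ⟨-, X_cases⟩ := hX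
  have : Y = 2 * Q := by omega
  rcases c₅ with rfl | ⟨-, rfl⟩ <;> omega

theorem false_of_three_three {P Q Y Y₄ Y₅ d : ℕ} (s : Scale P Q Y)
    (hY₄ : EvenTwoPow Y₄) (hY₅ : EvenTwoPow Y₅) (hd : 0 < d)
    (h₄ : 3 * P + Y + d = 9 * P + Y₄) (h₅ : 3 * P + Y + 2 * d = 9 * P + Y₅) : False := by
  have Y_mod := s.Y_mod
  have P₈ := s.P_mod_eight
  obtain ⟨p₄, D₄⟩ := hY₄
  obtain ⟨-, D₅⟩ := hY₅
  have e : 6 * P + 2 * Y₄ = Y + Y₅ := by omega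
  have l : Y₄ < Y₅ := by omega
  clear h₄ h₅
  rcases D₅ with rfl | rfl | rfl | rfl | D₅ <;> omega

theorem false_of_three_two_three {P Q Y Y₄ Y₆ d : ℕ} (s : Scale P Q Y)
    (hY₄ : EvenTwoPow Y₄) (hY₆ : EvenTwoPow Y₆) (hd : 0 < d)
    (h₄ : 3 * P + Y + d = 9 * P + Y₄) (h₆ : 3 * P + Y + 3 * d = 9 * P + Y₆) : False := by
  have Y_mod := s.Y_mod
  have P₈ := s.P_mod_eight
  obtain ⟨p₄, D₄⟩ := hY₄
  obtain ⟨-, D₆⟩ := hY₆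
  have e : 12 * P + 3 * Y₄ = Y₆ + 2 * Y := by omega
  have l : Y₄ < Y₆ := by omega
  clear h₄ h₆
  obtain ⟨rfl, rfl⟩ : Y₄ = 4 ∧ Y₆ = 16 := by
    rcases D₄ with rfl | rfl | rfl | rfl | D₄ <;> rcases D₆ with rfl | rfl | rfl | rfl | D₆ <;>
      omega
  obtain ⟨-, -, -, -, -, Y_eq, ne₁, ne₂, ne₄⟩ := s
  omega

theorem false_of_three_two_two {P Q Y X₅ X₆ Y₄ d : ℕ} (s : Scale P Q Y)
    (hX₅ : ThreePow X₅) (hX₆ : ThreePow X₆) (hY₄ : EvenTwoPow Y₄)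
    (hX : 3 * X₅ ≤ X₆)
    (h₄ : 3 * P + Y + d = 9 * P + Y₄) (h₅ : 3 * P + Y + 2 * d = X₅ + 8 * Q)
    (h₆ : 3 * P + Y + 3 * d = X₆ + 8 * Q) : False := by
  obtain ⟨P₈, P₉, P_ge, Q₃, Q_mod, Y_eq, -, -, -⟩ := s
  obtain ⟨A₅, C₅⟩ := hX₅
  obtain ⟨A₆, C₆⟩ := hX₆
  obtain ⟨-, D₄⟩ := hY₄
  have X₆_mod : X₆ % 3 = 0 := by clear * - C₆ A₅ hX; omega
  have e₁ : 3 * P + 2 * X₆ + Y = 3 * X₅ + 8 * Q := by clear * - h₅ h₆; omega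
  have e₂ : 9 * P + 2 * Y₄ + 6 * P = X₅ + 8 * Q + Y := by clear * - h₄ h₅; omega
  rcases Y_eq with rfl | rfl | rfl
  · clear * - e₁ hX P_ge; omega
  · clear * - e₁ X₆_mod P₉ Q₃; omega
  · obtain rfl : X₅ = 1 := by clear * - e₁ A₅ C₅ C₆ hX P₉ Q₃; omega
    obtain rfl : Y₄ = 2 := by
      clear * - e₂ P₈ Q_mod D₄
      rcases D₄ with rfl | rfl | rfl | rfl | D₄ <;> omega
    have e₃ : 9 * P + X₆ = 8 * Q := by clear * - e₁ e₂; omega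
    clear * - e₁ e₃ P₈ Q_mod A₆
    omega

theorem false_of_two_three_three {P Q Y X₄ Y₅ Y₆ d : ℕ} (s : Scale P Q Y)
    (hX₄ : ThreePow X₄) (hY₅ : EvenTwoPow Y₅) (hY₆ : EvenTwoPow Y₆) (hd : 0 < d)
    (h₄ : 3 * P + Y + d = X₄ + 8 * Q) (h₅ : 3 * P + Y + 2 * d = 9 * P + Y₅)
    (h₆ : 3 * P + Y + 3 * d = 9 * P + Y₆) : False := by
  have Y_mod := s.Y_mod
  obtain ⟨P₈, P₉, -, Q₃, Q_mod, -, -, -, -⟩ := s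
  obtain ⟨A₄, C₄⟩ := hX₄
  obtain ⟨-, D₅⟩ := hY₅
  obtain ⟨-, D₆⟩ := hY₆
  have e₁ : 6 * P + 3 * Y₅ = Y + 2 * Y₆ := by omega
  have e₂ : 9 * P + 2 * Y₅ = X₄ + 8 * Q + Y₆ := by omega
  have l : Y₅ < Y₆ := by omega
  clear h₄ h₅ h₆
  obtain rfl : Y₅ = 2 := by
    clear * - e₁ D₅ D₆ P₈ Y_mod
    rcases D₅ with rfl | rfl | rfl | rfl | D₅ <;> omega
  obtain rfl : Y₆ = 4 := by
    clear * - e₂ l A₄ D₆ P₈ Q_mod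
    rcases D₆ with rfl | rfl | rfl | rfl | D₆ <;> omega
  rcases C₄ with rfl | rfl | C₄ <;> omega

theorem false_of_two_three_two {P Q Y X₄ X₆ Y₅ d : ℕ} (s : Scale P Q Y)
    (hX₄ : ThreePow X₄) (hX₆ : ThreePow X₆) (hY₅ : EvenTwoPow Y₅)
    (hX : 3 * X₄ ≤ X₆)
    (h₄ : 3 * P + Y + d = X₄ + 8 * Q) (h₅ : 3 * P + Y + 2 * d = 9 * P + Y₅)
    (h₆ : 3 * P + Y + 3 * d = X₆ + 8 * Q) : False := by
  obtain ⟨P₈, P₉, P_ge, Q₃, Q_mod, Y_eq, -, -, -⟩ := s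
  obtain ⟨A₄, C₄⟩ := hX₄
  obtain ⟨A₆, C₆⟩ := hX₆
  obtain ⟨-, D₅⟩ := hY₅
  have X₆_mod : X₆ % 3 = 0 := by clear * - C₆ A₄ hX; omega
  have e₁ : 16 * Q + 3 * X₄ = 6 * P + X₆ + 2 * Y := by clear * - h₄ h₆; omega
  have e₂ : 18 * P + 2 * Y₅ = X₄ + X₆ + 16 * Q := by clear * - h₄ h₅ h₆; omega
  clear h₄ h₅ h₆
  rcases Y_eq with rfl | rfl | rfl
  · clear * - e₁ hX P_ge; omega
  · clear * - e₁ X₆_mod P₉ Q₃; omega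
  · obtain rfl : X₄ = 1 := by clear * - e₁ A₄ C₄ C₆ hX P₉ Q₃; omega
    clear C₄ C₆
    rcases D₅ with rfl | rfl | rfl | rfl | D₅ <;> omega

theorem false_of_two_two_three {P Q Y X₄ X₅ Y₆ d : ℕ} (s : Scale P Q Y)
    (hX₄ : ThreePow X₄) (hX₅ : ThreePow X₅) (hY₆ : EvenTwoPow Y₆)
    (hX : 3 * X₄ ≤ X₅)
    (h₄ : 3 * P + Y + d = X₄ + 8 * Q) (h₅ : 3 * P + Y + 2 * d = X₅ + 8 * Q)
    (h₆ : 3 * P + Y + 3 * d = 9 * P + Y₆) : False := by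
  obtain ⟨P₈, P₉, P_ge, Q₃, Q_mod, Y_eq, -, -, -⟩ := s
  obtain ⟨A₄, C₄⟩ := hX₄
  obtain ⟨A₅, C₅⟩ := hX₅
  obtain ⟨-, D₆⟩ := hY₆
  have X₅_mod : X₅ % 3 = 0 := by clear * - C₅ A₄ hX; omega
  have e₁ : 2 * X₄ + 8 * Q = X₅ + 3 * P + Y := by clear * - h₄ h₅; omega
  have e₂ : 2 * X₅ + 8 * Q = X₄ + 9 * P + Y₆ := by clear * - h₄ h₅ h₆; omega
  clear h₄ h₅ h₆
  rcases Y_eq with rfl | rfl | rfl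
  · clear * - e₁ hX P_ge; omega
  · obtain rfl : X₄ = 1 := by clear * - e₁ C₄ X₅_mod P₉ Q₃; omega
    obtain ⟨P_mod, X₅_mod'⟩ : P % 8 = 3 ∧ X₅ % 8 = 1 := by clear * - e₁ A₅ P₈ Q_mod; omega
    clear * - e₂ P_mod X₅_mod' Q_mod D₆
    rcases D₆ with rfl | rfl | rfl | rfl | D₆ <;> omega
  · obtain rfl : X₄ = 3 := by
      clear * - e₁ A₄ C₄ C₅ X₅_mod hX P₉ Q₃
      rcases C₄ with rfl | rfl | C₄
      · omega
      · rfl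
      · have : X₅ % 9 = 0 := by clear * - A₄ C₄ C₅ hX; omega
        omega
    obtain ⟨P_mod, X₅_mod'⟩ : P % 8 = 1 ∧ X₅ % 8 = 3 := by clear * - e₁ A₅ P₈ Q_mod; omega
    clear * - e₁ e₂ P_mod X₅_mod X₅_mod' Q_mod D₆ P₉ C₅ Q₃
    obtain rfl : Y₆ = 2 := by rcases D₆ with rfl | rfl | rfl | rfl | D₆ <;> omega
    omega

end Scale

/-- The last four terms `3 * 3 ^ p + Y, 3 ^ xᵢ + 2 ^ yᵢ` of a progression of odd terms cannot
all be built from dominant powers. -/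
theorem no_dominant_progression {a d p q x₄ y₄ x₅ y₅ x₆ y₆ Y : ℕ} (hd : 0 < d)
    (ha₂ : a % 2 = 1) (hd₂ : d % 2 = 0)
    (hp : 7 ≤ p) (hq : 11 ≤ q)
    (hY : Y = 8 * 2 ^ q ∨ Y = 4 * 2 ^ q ∨ Y = 2 * 2 ^ q)
    (h₃ : a + 3 * d = 3 * 3 ^ p + Y) (h₄ : a + 4 * d = 3 ^ x₄ + 2 ^ y₄)
    (h₅ : a + 5 * d = 3 ^ x₅ + 2 ^ y₅) (h₆ : a + 6 * d = 3 ^ x₆ + 2 ^ y₆)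
    (c₄ : (3 ^ x₄ = 9 * 3 ^ p) ∨ (3 ^ x₄ < 9 * 3 ^ p ∧ 2 ^ y₄ = 8 * 2 ^ q) ∨
      (3 ^ x₄ = 3 * 3 ^ p ∧ 2 ^ y₄ = 4 * 2 ^ q))
    (c₅ : (3 ^ x₅ = 9 * 3 ^ p) ∨ (3 ^ x₅ < 9 * 3 ^ p ∧ 2 ^ y₅ = 8 * 2 ^ q))
    (c₆ : (3 ^ x₆ = 9 * 3 ^ p) ∨ (3 ^ x₆ < 9 * 3 ^ p ∧ 2 ^ y₆ = 8 * 2 ^ q)) : False := by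
  have s := scale_pow hp hq hY
  have t₄ := threePow_pow x₄
  have t₅ := threePow_pow x₅
  have t₆ := threePow_pow x₆
  have u₄ := evenTwoPow_pow (k := y₄) (by have := t₄.mod_eight; omega)
  have u₅ := evenTwoPow_pow (k := y₅) (by have := t₅.mod_eight; omega)
  have v₅ : 2 ^ y₅ % 3 ≠ 0 := by have := two_pow_mod_three y₅; omega
  have u₆ := evenTwoPow_pow (k := y₆) (by have := t₆.mod_eight; omega)
  have E₄₅ := mul_pow_le_pow_of_pow_lt (b := 3) (x := x₄) (z := x₅) (by norm_num)
  have E₅₆ := mul_pow_le_pow_of_pow_lt (b := 3) (x := x₅) (z := x₆) (by norm_num)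
  have E₄₆ := mul_pow_le_pow_of_pow_lt (b := 3) (x := x₄) (z := x₆) (by norm_num)
  clear hY ha₂ hd₂
  generalize 3 ^ p = P at *
  generalize 2 ^ q = Q at *
  generalize 3 ^ x₄ = X₄ at *
  generalize 3 ^ x₅ = X₅ at *
  generalize 3 ^ x₆ = X₆ at *
  generalize 2 ^ y₄ = Y₄ at *
  generalize 2 ^ y₅ = Y₅ at *
  generalize 2 ^ y₆ = Y₆ at *
  have g₄ : 3 * P + Y + d = X₄ + Y₄ := by omega
  have g₅ : 3 * P + Y + 2 * d = X₅ + Y₅ := by omega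
  have g₆ : 3 * P + Y + 3 * d = X₆ + Y₆ := by omega
  clear h₃ h₄ h₅ h₆
  rcases c₄ with rfl | ⟨-, rfl⟩ | ⟨rfl, rfl⟩
  · rcases c₅ with rfl | ⟨-, rfl⟩
    · exact s.false_of_three_three u₄ u₅ hd g₄ g₅
    · rcases c₆ with rfl | ⟨-, rfl⟩
      · exact s.false_of_three_two_three u₄ u₆ hd g₄ g₆
      · exact s.false_of_three_two_two t₅ t₆ u₄ (E₅₆ (by omega)) g₄ g₅ g₆
  · rcases c₅ with rfl | ⟨-, rfl⟩
    · rcases c₆ with rfl | ⟨-, rfl⟩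
      · exact s.false_of_two_three_three t₄ u₅ u₆ hd g₄ g₅ g₆
      · exact s.false_of_two_three_two t₄ t₆ u₅ (E₄₆ (by omega)) g₄ g₅ g₆
    · rcases c₆ with rfl | ⟨-, rfl⟩
      · exact s.false_of_two_two_three t₄ t₅ u₆ (E₄₅ (by omega)) g₄ g₅ g₆
      · have := E₄₅ (by omega)
        have := E₅₆ (by omega)
        omega
  · exact s.false_of_both t₅ v₅ hd g₄ g₅ c₅

/-- Under the standing hypotheses, a + 3d is not of the 3-weak dominated form 3^(m-1) + 2^y. -/
theorem a4_not_3_weak_dominated (a d m n : ℕ)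
    (ha : 0 < a) (hd : 0 < d)
    (hAP : ∀ i : ℕ, i ≤ 6 → ∃ x y : ℕ, a + i * d = 3 ^ x + 2 ^ y)
    (hbig : 3 ^ 9 ≤ a + 6 * d)
    (hm₁ : 3 ^ m ≤ a + 6 * d) (hm₂ : a + 6 * d < 3 ^ (m + 1))
    (hn₁ : 2 ^ n ≤ a + 6 * d) (hn₂ : a + 6 * d < 2 ^ (n + 1)) :
    ¬ ∃ y : ℕ, a + 3 * d = 3 ^ (m - 1) + 2 ^ y := by
  rintro ⟨y, h₃⟩
  have hm : 9 < m + 1 := (Nat.pow_lt_pow_iff_right (a := 3) (by norm_num)).1 (hbig.trans_lt hm₂)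
  have hn : 14 < n + 1 := (Nat.pow_lt_pow_iff_right (a := 2) (by norm_num)).1
    ((show 2 ^ 14 ≤ 3 ^ 9 by norm_num).trans_lt (hbig.trans_lt hn₂))
  obtain ⟨p, rfl⟩ := Nat.exists_eq_add_of_le' (show 2 ≤ m by omega)
  obtain ⟨q, rfl⟩ := Nat.exists_eq_add_of_le' (show 3 ≤ n by omega)
  rw [show p + 2 - 1 = p + 1 by omega, pow_succ'] at h₃
  rw [show 3 ^ (p + 2) = 9 * 3 ^ p by ring] at hm₁
  rw [show 3 ^ (p + 2 + 1) = 27 * 3 ^ p by ring] at hm₂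
  rw [show 2 ^ (q + 3) = 8 * 2 ^ q by ring] at hn₁
  rw [show 2 ^ (q + 3 + 1) = 16 * 2 ^ q by ring] at hn₂
  obtain ⟨ha₂, hd₂⟩ := odd_and_even_of_progression hd hAP
  obtain ⟨x₄, y₄, h₄⟩ := hAP 4 (by norm_num)
  obtain ⟨x₅, y₅, h₅⟩ := hAP 5 (by norm_num)
  obtain ⟨x₆, y₆, h₆⟩ := hAP 6 (by norm_num)
  have c₃ := two_pow_eq_of_half_lt hm₁ hn₁ hn₂ h₃ (by omega) (by omega)
  have c₄ := dominant_power_cases hm₁ hm₂ hn₁ hn₂ h₄ (by omega) (by omega)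
  have c₅ := dominant_power_cases hm₁ hm₂ hn₁ hn₂ h₅ (by omega) (by omega)
  have c₆ := dominant_power_cases hm₁ hm₂ hn₁ hn₂ h₆ (by omega) (by omega)
  exact no_dominant_progression hd ha₂ hd₂ (by omega) (by omega) c₃ h₃ h₄ h₅ h₆ c₄
    (by omega) (by omega)
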